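/- arXiv:funct-an/9707010 — 3 statements merged into one kernel-verified Lean document; each statement's English description precedes it below -/
import Mathlib

section
/- Let (α_z)_{z∈ℂ} be an analytic one-parameter group on A relative to φ. Then for every z ∈ ℂ and every a ∈ A one has (α_z(a))* = α_{conj(z)}(a*). -/
open scoped ComplexOrder

/-- An analytic one-parameter group on a (not necessarily unital) complex `*`-algebra `A`,
relative to a linear functional `φ` : a family `(α z)_{z ∈ ℂ}` of algebra homomorphisms
`A → A` such that each `α t` (`t` real) is a `*`-automorphism, the real group law holds,
each real `α t` scales `φ` by a strictly positive constant, and all the functions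
`z ↦ φ (b * α z a)` and `z ↦ φ (α z a * b)` are entire. -/
structure AnalyticOneParamGroup {A : Type*} [NonUnitalRing A] [Module ℂ A]
    [SMulCommClass ℂ A A] [IsScalarTower ℂ A A] [StarRing A] [StarModule ℂ A]
    (φ : A →ₗ[ℂ] ℂ) (α : ℂ → A → A) : Prop where
  map_add : ∀ (z : ℂ) (a b : A), α z (a + b) = α z a + α z b
  map_smul : ∀ (z : ℂ) (c : ℂ) (a : A), α z (c • a) = c • α z a
  map_mul : ∀ (z : ℂ) (a b : A), α z (a * b) = α z a * α z b
  real_star : ∀ (t : ℝ) (a : A), α (t : ℂ) (star a) = star (α (t : ℂ) a)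
  real_bijective : ∀ t : ℝ, Function.Bijective (α (t : ℂ))
  real_group : ∀ (s t : ℝ) (a : A), α ((s : ℂ) + (t : ℂ)) a = α (s : ℂ) (α (t : ℂ) a)
  real_rel_invariant : ∀ t : ℝ, ∃ c : ℝ, 0 < c ∧ ∀ a : A, φ (α (t : ℂ) a) = (c : ℂ) * φ a
  entire_left : ∀ a b : A, Differentiable ℂ fun z : ℂ => φ (b * α z a)
  entire_right : ∀ a b : A, Differentiable ℂ fun z : ℂ => φ (α z a * b)

/-- Two entire functions that agree on the real line are equal. -/
theorem eq_of_entire_of_eq_on_real {f g : ℂ → ℂ} (hf : Differentiable ℂ f)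
    (hg : Differentiable ℂ g) (h : ∀ t : ℝ, f t = g t) : f = g := by
  have hf' : AnalyticOnNhd ℂ f Set.univ := hf.differentiableOn.analyticOnNhd isOpen_univ
  have hg' : AnalyticOnNhd ℂ g Set.univ := hg.differentiableOn.analyticOnNhd isOpen_univ
  refine hf'.eq_of_frequently_eq (z₀ := ((0 : ℝ) : ℂ)) hg' ?_
  have hmap : Filter.Tendsto (fun t : ℝ => (t : ℂ)) (nhdsWithin 0 {0}ᶜ)
      (nhdsWithin ((0 : ℝ) : ℂ) {((0 : ℝ) : ℂ)}ᶜ) :=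
    Complex.continuous_ofReal.continuousWithinAt.tendsto_nhdsWithin
      fun t ht => by simpa using ht
  exact hmap.frequently (Filter.Frequently.of_forall h)

/-- The sesquilinear form `(x, y) ↦ φ (star x * y)` of a positive functional is Hermitian. -/
theorem conj_apply_star_mul_of_nonneg {A : Type*} [NonUnitalRing A] [Module ℂ A]
    [SMulCommClass ℂ A A] [IsScalarTower ℂ A A] [StarRing A] [StarModule ℂ A]
    (φ : A →ₗ[ℂ] ℂ) (hpos : ∀ a : A, 0 ≤ φ (star a * a)) (x y : A) :
    starRingEnd ℂ (φ (star x * y)) = φ (star y * x) := by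
  have him (a : A) : (φ (star a * a)).im = 0 := (Complex.nonneg_iff.1 (hpos a)).2.symm
  have h₁ := him (x + y)
  have h₂ := him (x + Complex.I • y)
  simp only [star_add, star_smul, add_mul, mul_add, map_add, smul_mul_assoc, mul_smul_comm,
    map_smul, Complex.add_im, smul_eq_mul, him, Complex.mul_im, Complex.mul_re, Complex.star_def,
    Complex.conj_I, Complex.neg_re, Complex.neg_im, Complex.I_re, Complex.I_im] at h₁ h₂
  apply Complex.ext
  · rw [Complex.conj_re]
    linarith
  · rw [Complex.conj_im]
    linarith

/-- For an analytic one-parameter group `α` relative to a positive faithful functional `φ`,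
one has `(α z a)* = α (conj z) (a*)` for every `z ∈ ℂ` and `a ∈ A`. -/
theorem analyticOneParamGroup_star {A : Type*} [NonUnitalRing A] [Module ℂ A]
    [SMulCommClass ℂ A A] [IsScalarTower ℂ A A] [StarRing A] [StarModule ℂ A]
    (φ : A →ₗ[ℂ] ℂ)
    (hpos : ∀ a : A, 0 ≤ φ (star a * a))
    (hfaith : ∀ a : A, φ (star a * a) = 0 → a = 0)
    (α : ℂ → A → A) (hα : AnalyticOneParamGroup φ α)
    (z : ℂ) (a : A) :
    star (α z a) = α (starRingEnd ℂ z) (star a) := by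
  have key (c : A) : φ (α z a * c) = φ (star (α (starRingEnd ℂ z) (star a)) * c) := by
    have hconj (w : ℂ) : φ (star (α (starRingEnd ℂ w) (star a)) * c) =
        starRingEnd ℂ (φ (star c * α (starRingEnd ℂ w) (star a))) :=
      (conj_apply_star_mul_of_nonneg φ hpos _ _).symm
    refine congrFun (eq_of_entire_of_eq_on_real (hα.entire_right a c)
      (g := fun w => φ (star (α (starRingEnd ℂ w) (star a)) * c)) ?_ fun t => ?_) z
    · simp only [hconj]
      exact fun w => differentiableAt_conj_conj_iff.2 (hα.entire_left (star a) (star c) _)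
    · simp only [Complex.conj_ofReal, hα.real_star, star_star]
  refine sub_eq_zero.1 (hfaith _ ?_)
  rw [star_sub, star_star, sub_mul, map_sub, key, sub_self]
end

section
/- Let (α_z)_{z∈ℂ} be an analytic one-parameter group on A relative to φ, and assume A ≠ {0} (equivalently φ ≠ 0). Then there exists a unique strictly positive real number λ such that φ(α_t(a)) = λ^t · φ(a) for every t ∈ ℝ and every a ∈ A. -/
open scoped ComplexOrder

namespace AnalyticOneParamGroup

variable {A : Type*} [NonUnitalRing A] [Module ℂ A] [SMulCommClass ℂ A A]
  [IsScalarTower ℂ A A] [StarRing A] [StarModule ℂ A] {φ : A →ₗ[ℂ] ℂ} {α : ℂ → A → A}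

lemma apply_zero (hα : AnalyticOneParamGroup φ α) (a : A) : α 0 a = a := by
  have h := hα.real_group 0 0 a
  simp only [Complex.ofReal_zero, add_zero] at h
  exact (by simpa using (hα.real_bijective 0).1 : Function.Injective (α 0)) h.symm

/-- The scaling constants of an analytic one-parameter group are bounded away from zero near
`t = 0`. -/
lemma eventually_half_le_scaling (hα : AnalyticOneParamGroup φ α)
    (hpos : ∀ a : A, 0 ≤ φ (star a * a)) {a : A} (ha : φ (star a * a) ≠ 0) {c : ℝ → ℝ}
    (hc : ∀ (t : ℝ) (x : A), φ (α t x) = c t * φ x) :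
    ∀ᶠ t in nhds (0 : ℝ), 1 / 2 ≤ c t := by
  set N : ℝ := (φ (star a * a)).re with hN
  have hNφ : φ (star a * a) = N := by
    apply Complex.ext
    · simp [hN]
    · simpa using (Complex.nonneg_iff.mp (hpos a)).2.symm
  have hNpos : 0 < N := by
    refine lt_of_le_of_ne (Complex.nonneg_iff.mp (hpos a)).1 fun h => ha ?_
    rw [hNφ, ← h, Complex.ofReal_zero]
  let h : ℝ → ℝ := fun t => (φ (star a * α t a) + φ (α t (star a) * a)).re
  have hcont : Continuous h :=
    Complex.continuous_re.comp
      (((hα.entire_left a (star a)).continuous.comp Complex.continuous_ofReal).add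
        ((hα.entire_right (star a) a).continuous.comp Complex.continuous_ofReal))
  have h0 : h 0 = 2 * N := by
    simp only [h, Complex.ofReal_zero, hα.apply_zero, hNφ, Complex.add_re, Complex.ofReal_re]
    ring
  have hle : ∀ t, h t ≤ N + c t * N := by
    intro t
    have h1 := (Complex.nonneg_iff.mp (hpos (a - α t a))).1
    have h2 : φ (star (α t a) * α t a) = c t * N := by
      rw [← hα.real_star, ← hα.map_mul, hc, hNφ]
    rw [star_sub, sub_mul, mul_sub, mul_sub, map_sub, map_sub, map_sub, h2, hNφ,
      ← hα.real_star] at h1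
    simp only [Complex.sub_re, Complex.ofReal_re, Complex.re_ofReal_mul] at h1
    simp only [h, Complex.add_re]
    linarith
  have hev : ∀ᶠ t in nhds (0 : ℝ), 3 / 2 * N < h t :=
    hcont.continuousAt.eventually (lt_mem_nhds (by rw [h0]; linarith))
  filter_upwards [hev] with t ht
  have := hle t
  by_contra! hlt
  nlinarith

end AnalyticOneParamGroup

/-- A function `c : ℝ → ℝ` with positive values turning sums into products, and bounded away from
zero near the origin, is an exponential. -/
lemma eq_rpow_of_map_add_eq_mul {c : ℝ → ℝ} (hc : ∀ t, 0 < c t)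
    (hadd : ∀ s t, c (s + t) = c s * c t) {δ : ℝ} (hδ : 0 < δ)
    (hev : ∀ᶠ t in nhds (0 : ℝ), δ ≤ c t) (t : ℝ) : c t = c 1 ^ t := by
  let f : ℝ →+ ℝ := AddMonoidHom.mk' (fun t => Real.log (c t)) fun s t => by
    rw [hadd, Real.log_mul (hc s).ne' (hc t).ne']
  have hf : ∀ t, f t = Real.log (c t) := fun _ => rfl
  have hneg : ∀ᶠ t in nhds (0 : ℝ), δ ≤ c (-t) :=
    (continuous_neg.tendsto' (0 : ℝ) 0 neg_zero).eventually hev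
  have hcont : Continuous f := by
    refine f.continuous_of_isBounded_nhds_zero (Filter.inter_mem hev hneg)
      ((Metric.isBounded_Icc (Real.log δ) (-Real.log δ)).subset ?_)
    rintro _ ⟨t, ⟨h1, h2⟩, rfl⟩
    have h3 : Real.log δ ≤ f (-t) := Real.log_le_log hδ h2
    rw [map_neg] at h3
    exact ⟨Real.log_le_log hδ h1, by linarith⟩
  have hlin : f t = t * f 1 := by
    simpa using map_real_smul f hcont t 1
  rw [Real.rpow_def_of_pos (hc 1), mul_comm, ← hf, ← hlin, hf, Real.exp_log (hc t)]

/-- If `A ≠ {0}` then there is a unique strictly positive real number `λ` such that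
`φ (α t a) = λ ^ t * φ a` for every real `t` and every `a ∈ A`. -/
theorem analyticOneParamGroup_scaling_constant {A : Type*} [NonUnitalRing A] [Module ℂ A]
    [SMulCommClass ℂ A A] [IsScalarTower ℂ A A] [StarRing A] [StarModule ℂ A]
    (φ : A →ₗ[ℂ] ℂ)
    (hpos : ∀ a : A, 0 ≤ φ (star a * a))
    (hfaith : ∀ a : A, φ (star a * a) = 0 → a = 0)
    (α : ℂ → A → A) (hα : AnalyticOneParamGroup φ α)
    (hA : ∃ a : A, a ≠ 0) :
    ∃! lam : ℝ, 0 < lam ∧ ∀ (t : ℝ) (a : A), φ (α (t : ℂ) a) = ((lam ^ t : ℝ) : ℂ) * φ a := by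
  obtain ⟨a, ha⟩ := hA
  have hφa : φ (star a * a) ≠ 0 := fun h => ha (hfaith a h)
  choose c hc hcφ using hα.real_rel_invariant
  have hadd : ∀ s t, c (s + t) = c s * c t := by
    intro s t
    have h := hcφ (s + t) (star a * a)
    rw [Complex.ofReal_add, hα.real_group, hcφ, hcφ, ← mul_assoc] at h
    exact_mod_cast (mul_right_cancel₀ hφa h).symm
  have hexp := eq_rpow_of_map_add_eq_mul hc hadd one_half_pos
    (hα.eventually_half_le_scaling hpos hφa hcφ)
  refine ⟨c 1, ⟨hc 1, fun t x => by rw [hcφ, ← hexp]⟩, ?_⟩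
  rintro l ⟨-, hl⟩
  have h := (hl 1 (star a * a)).symm.trans (hcφ 1 (star a * a))
  rw [Real.rpow_one] at h
  exact_mod_cast mul_right_cancel₀ hφa h
end

section
/- Analytic unitary representations are determined by their value at i: if (u_z)_{z∈ℂ} and (v_z)_{z∈ℂ} are analytic unitary representations on A and u_i = v_i, then u_z = v_z for every z ∈ ℂ. -/
open scoped ComplexOrder

/-- An analytic unitary representation on a unital complex `*`-algebra `A` : a family
`(u z)_{z ∈ ℂ}` of elements of `A` such that `u t` is unitary for every real `t`, the real
group law holds, and the functions `z ↦ φ (a * u z)` and `z ↦ φ (u z * a)` are entire. -/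
structure AnalyticUnitaryRep {A : Type*} [Ring A] [Algebra ℂ A] [StarRing A]
    [StarModule ℂ A] (φ : A →ₗ[ℂ] ℂ) (u : ℂ → A) : Prop where
  real_unitary : ∀ t : ℝ, star (u (t : ℂ)) * u (t : ℂ) = 1 ∧ u (t : ℂ) * star (u (t : ℂ)) = 1
  real_group : ∀ s t : ℝ, u ((s : ℂ) + (t : ℂ)) = u (s : ℂ) * u (t : ℂ)
  entire_left : ∀ a : A, Differentiable ℂ fun z : ℂ => φ (a * u z)
  entire_right : ∀ a : A, Differentiable ℂ fun z : ℂ => φ (u z * a)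

open Complex Filter Topology
open scoped ComplexConjugate

/-- A jointly continuous function of two complex variables which is entire in each variable
separately is entire. -/
theorem Complex.differentiable_uncurry_of_continuous {G : ℂ → ℂ → ℂ}
    (hc : Continuous fun p : ℂ × ℂ => G p.1 p.2)
    (h₁ : ∀ w, Differentiable ℂ fun z => G z w) (h₂ : ∀ z, Differentiable ℂ (G z)) :
    Differentiable ℂ fun p : ℂ × ℂ => G p.1 p.2 := by
  have key : ∀ H : ℂ → ℂ → ℂ, (Continuous fun p : ℂ × ℂ => H p.1 p.2) →
      (∀ w, Differentiable ℂ (H w)) → Continuous fun p : ℂ × ℂ => deriv (H p.1) p.2 := by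
    intro H hH hd
    rw [continuous_iff_continuousAt]
    rintro ⟨w₀, z₀⟩
    have h : TendstoLocallyUniformly (fun p : ℂ × ℂ => H p.1) (H w₀) (𝓝 (w₀, z₀)) :=
      ContinuousMap.tendsto_iff_tendstoLocallyUniformly.1
        (((ContinuousMap.curry ⟨_, hH⟩).continuous.comp continuous_fst).tendsto (w₀, z₀))
    have h' := (tendstoLocallyUniformlyOn_univ.2 h).deriv
      (.of_forall fun p => (hd p.1).differentiableOn) isOpen_univ
    exact (tendstoLocallyUniformlyOn_univ.1 h').tendsto_comp
      (hd w₀).deriv.continuous.continuousAt continuous_snd.continuousAt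
  have c₁ : Continuous fun p : ℂ × ℂ => deriv (fun z => G z p.2) p.1 :=
    (key (fun w z => G z w) (hc.comp continuous_swap) h₁).comp continuous_swap
  have c₂ : Continuous fun p : ℂ × ℂ => deriv (G p.1) p.2 := key G hc h₂
  intro p
  exact (hasStrictFDerivAt_uncurry_coprod (f := G)
    (f₁ := fun z w => ContinuousLinearMap.toSpanSingleton ℂ (deriv (fun z => G z w) z))
    (f₂ := fun z w => ContinuousLinearMap.toSpanSingleton ℂ (deriv (G z) w))
    (.of_forall fun v => (h₁ v.2 v.1).hasDerivAt.hasFDerivAt)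
    (.of_forall fun v => (h₂ v.1 v.2).hasDerivAt.hasFDerivAt)
    ((ContinuousLinearMap.toSpanSingletonCLE (𝕜 := ℂ) (E := ℂ)).continuous.comp c₁).continuousAt
    ((ContinuousLinearMap.toSpanSingletonCLE (𝕜 := ℂ) (E := ℂ)).continuous.comp
      c₂).continuousAt).hasFDerivAt.differentiableAt

/-- Two entire functions which agree on the real line are equal. -/
theorem Differentiable.eq_of_eq_ofReal {f g : ℂ → ℂ} (hf : Differentiable ℂ f)
    (hg : Differentiable ℂ g) (h : ∀ t : ℝ, f t = g t) (z : ℂ) : f z = g z := by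
  refine congrFun (AnalyticOnNhd.eq_of_frequently_eq (z₀ := 0)
    (fun z _ => hf.analyticAt z) (fun z _ => hg.analyticAt z) ?_) z
  have ht : Tendsto (fun t : ℝ => (t : ℂ)) (𝓝[≠] 0) (𝓝[≠] 0) := by
    refine tendsto_nhdsWithin_of_tendsto_nhds_of_eventually_within _ ?_ ?_
    · exact (continuous_ofReal.tendsto' 0 0 ofReal_zero).mono_left nhdsWithin_le_nhds
    · filter_upwards [self_mem_nhdsWithin] with t ht
      simpa using ht
  exact ht.frequently (Eventually.of_forall h).frequently

section PositiveFunctional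

variable {A : Type*} [Ring A] [Algebra ℂ A] [StarRing A] {φ : A →ₗ[ℂ] ℂ}

theorem eq_of_forall_map_mul_left_eq (hfaith : ∀ a : A, φ (star a * a) = 0 → a = 0) {x y : A}
    (h : ∀ a, φ (a * x) = φ (a * y)) : x = y := by
  refine sub_eq_zero.1 (hfaith _ ?_)
  rw [mul_sub, map_sub, h, sub_self]

theorem eq_of_forall_map_mul_right_eq (hfaith : ∀ a : A, φ (star a * a) = 0 → a = 0) {x y : A}
    (h : ∀ a, φ (x * a) = φ (y * a)) : x = y := by
  refine sub_eq_zero.1 (star_eq_zero.1 (hfaith _ ?_))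
  rw [star_star, sub_mul, map_sub, h, sub_self]

variable [StarModule ℂ A]

theorem map_star_of_forall_nonneg (hpos : ∀ a : A, 0 ≤ φ (star a * a)) (x : A) :
    φ (star x) = conj (φ x) := by
  have him : ∀ a : A, (φ (star a * a)).im = 0 := fun a => (Complex.le_def.1 (hpos a)).2.symm
  have h₀ := him 1
  have h₁ := him x
  have h₂ := him (1 + x)
  have h₃ := him (1 + Complex.I • x)
  simp only [star_add, star_one, star_smul, add_mul, mul_add, one_mul, mul_one, map_add,
    smul_mul_assoc, mul_smul_comm, map_smul, smul_eq_mul, Complex.add_im, Complex.mul_im,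
    Complex.mul_re, RCLike.star_def, Complex.conj_I, Complex.neg_re, Complex.neg_im,
    Complex.I_re, Complex.I_im] at h₀ h₁ h₂ h₃
  apply Complex.ext <;> simp only [Complex.conj_re, Complex.conj_im] <;> linarith

/-- The Cauchy-Schwarz inequality for a positive functional. -/
theorem sq_norm_map_mul_le (hpos : ∀ a : A, 0 ≤ φ (star a * a)) (a b : A) :
    ‖φ (a * b)‖ ^ 2 ≤ (φ (a * star a)).re * (φ (star b * b)).re := by
  let c : PreInnerProductSpace.Core ℂ A :=
    { inner := fun x y => φ (star x * y)
      conj_inner_symm := fun x y => by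
        change conj (φ (star y * x)) = φ (star x * y)
        rw [← map_star_of_forall_nonneg hpos, star_mul, star_star]
      re_inner_nonneg := fun x => (Complex.le_def.1 (hpos x)).1
      add_left := fun x y z => by
        change φ (star (x + y) * z) = φ (star x * z) + φ (star y * z)
        rw [star_add, add_mul, map_add]
      smul_left := fun x y r => by
        change φ (star (r • x) * y) = conj r * φ (star x * y)
        rw [star_smul, smul_mul_assoc, map_smul, smul_eq_mul, RCLike.star_def] }
  have h : ‖φ (star (star a) * b)‖ * ‖φ (star b * star a)‖ ≤
      (φ (star (star a) * star a)).re * (φ (star b * b)).re :=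
    @InnerProductSpace.Core.inner_mul_inner_self_le ℂ A _ _ _ c (star a) b
  rwa [← star_mul, map_star_of_forall_nonneg hpos, Complex.norm_conj, star_star, ← sq] at h

namespace AnalyticUnitaryRep

variable {u v : ℂ → A}

theorem map_zero (hu : AnalyticUnitaryRep φ u) : u 0 = 1 := by
  have h := hu.real_group 0 0
  have h₁ := (hu.real_unitary 0).1
  simp only [ofReal_zero, add_zero] at h h₁
  calc u 0 = star (u 0) * u 0 * u 0 := by rw [h₁, one_mul]
    _ = 1 := by rw [mul_assoc, ← h, h₁]

/-- The group law of an analytic unitary representation holds for all complex parameters. -/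
theorem map_add (hu : AnalyticUnitaryRep φ u) (hfaith : ∀ a : A, φ (star a * a) = 0 → a = 0)
    (z w : ℂ) : u (z + w) = u z * u w := by
  have h : ∀ (z : ℂ) (t : ℝ), u (z + t) = u z * u t := fun z t =>
    eq_of_forall_map_mul_right_eq hfaith fun a => by
      have := Differentiable.eq_of_eq_ofReal
        ((hu.entire_right a).comp (differentiable_id.add_const (t : ℂ)))
        (hu.entire_right (u t * a)) (fun s => by simp [hu.real_group, mul_assoc]) z
      simpa [mul_assoc] using this
  refine eq_of_forall_map_mul_left_eq hfaith fun a => ?_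
  have := Differentiable.eq_of_eq_ofReal
    ((hu.entire_left a).comp (differentiable_id.const_add z))
    (hu.entire_left (a * u z)) (fun s => by simp [h, mul_assoc]) w
  simpa [mul_assoc] using this

theorem star_ofReal (hu : AnalyticUnitaryRep φ u) (t : ℝ) : star (u t) = u (-t) := by
  have h : u t * u (-t) = 1 := by
    have := hu.real_group t (-t)
    rw [ofReal_neg, add_neg_cancel, hu.map_zero] at this
    exact this.symm
  calc star (u t) = star (u t) * u t * u (-t) := by rw [mul_assoc, h, mul_one]
    _ = u (-t) := by rw [(hu.real_unitary t).1, one_mul]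

theorem star_apply (hu : AnalyticUnitaryRep φ u) (hpos : ∀ a : A, 0 ≤ φ (star a * a))
    (hfaith : ∀ a : A, φ (star a * a) = 0 → a = 0) (z : ℂ) : star (u z) = u (-conj z) := by
  refine eq_of_forall_map_mul_right_eq hfaith fun a => ?_
  have hs : ∀ w, φ (star (u w) * a) = conj (φ (star a * u w)) := fun w => by
    rw [← map_star_of_forall_nonneg hpos, star_mul, star_star]
  have := Differentiable.eq_of_eq_ofReal (f := conj ∘ (fun w => φ (star a * u w)) ∘ conj)
    (fun w => by
      simpa using (hu.entire_left (star a) (conj w)).conj_conj)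
    ((hu.entire_right a).comp differentiable_neg)
    (fun t => by simp [← hs, hu.star_ofReal]) (conj z)
  simpa [hs] using this

theorem map_mul_star (hu : AnalyticUnitaryRep φ u) (hpos : ∀ a : A, 0 ≤ φ (star a * a))
    (hfaith : ∀ a : A, φ (star a * a) = 0 → a = 0) (z : ℂ) :
    u z * star (u z) = u (2 * z.im * I) := by
  rw [hu.star_apply hpos hfaith, ← hu.map_add hfaith, ← sub_eq_add_neg, sub_conj]
  push_cast; rfl

theorem map_star_mul (hu : AnalyticUnitaryRep φ u) (hpos : ∀ a : A, 0 ≤ φ (star a * a))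
    (hfaith : ∀ a : A, φ (star a * a) = 0 → a = 0) (z : ℂ) :
    star (u z) * u z = u (2 * z.im * I) := by
  rw [hu.star_apply hpos hfaith, ← hu.map_add hfaith, neg_add_eq_sub, sub_conj]
  push_cast; rfl

theorem continuous_map_comp (hu : AnalyticUnitaryRep φ u) {X : Type*} [TopologicalSpace X]
    {g : X → ℂ} (hg : Continuous g) : Continuous fun x => φ (u (g x)) := by
  simpa [Function.comp_def] using (hu.entire_left 1).continuous.comp hg

theorem continuous_map_mul (hu : AnalyticUnitaryRep φ u) (hv : AnalyticUnitaryRep φ v)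
    (hpos : ∀ a : A, 0 ≤ φ (star a * a)) (hfaith : ∀ a : A, φ (star a * a) = 0 → a = 0) :
    Continuous fun p : ℂ × ℂ => φ (u p.1 * v p.2) := by
  rw [continuous_iff_continuousAt]
  rintro ⟨z₀, w₀⟩
  let q : ℂ × ℂ → ℝ := fun p =>
    (φ (u (p.1 - conj p.1)) - φ (u (p.1 - conj z₀)) - φ (u (z₀ - conj p.1)) +
      φ (u (z₀ - conj z₀))).re * (φ (v (2 * p.2.im * I))).re
  have hq : Continuous q :=
    (continuous_re.comp ((((hu.continuous_map_comp (by fun_prop)).sub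
      (hu.continuous_map_comp (by fun_prop))).sub (hu.continuous_map_comp (by fun_prop))).add
      continuous_const)).mul (continuous_re.comp (hv.continuous_map_comp (by fun_prop)))
  have hb : ∀ p : ℂ × ℂ, ‖φ ((u p.1 - u z₀) * v p.2)‖ ≤ √(q p) := fun p => by
    refine Real.le_sqrt_of_sq_le ((sq_norm_map_mul_le hpos _ _).trans_eq ?_)
    rw [hv.map_star_mul hpos hfaith, star_sub, sub_mul, mul_sub, mul_sub,
      hu.star_apply hpos hfaith, hu.star_apply hpos hfaith]
    simp only [← hu.map_add hfaith, ← sub_eq_add_neg, map_sub, q]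
    congr 2
    ring
  have h₁ : Tendsto (fun p : ℂ × ℂ => φ ((u p.1 - u z₀) * v p.2)) (𝓝 (z₀, w₀)) (𝓝 0) :=
    squeeze_zero_norm hb (hq.sqrt.tendsto' _ _ (by simp [q]))
  have h₂ : Tendsto (fun p : ℂ × ℂ => φ (u z₀ * v p.2)) (𝓝 (z₀, w₀)) (𝓝 (φ (u z₀ * v w₀))) :=
    ((hv.entire_left (u z₀)).continuous.comp continuous_snd).tendsto (z₀, w₀)
  have h₃ := h₁.add h₂
  simp only [← LinearMap.map_add, ← add_mul, sub_add_cancel, zero_add] at h₃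
  exact h₃

theorem map_mul_neg_eq (hu : AnalyticUnitaryRep φ u) (hv : AnalyticUnitaryRep φ v)
    (hpos : ∀ a : A, 0 ≤ φ (star a * a)) (hfaith : ∀ a : A, φ (star a * a) = 0 → a = 0)
    (hI : u I = v I) (z : ℂ) : φ (u z * v (-z)) = φ 1 := by
  have hd : Differentiable ℂ fun z => φ (u z * v (-z)) :=
    (Complex.differentiable_uncurry_of_continuous (G := fun z w => φ (u z * v w))
      (hu.continuous_map_mul hv hpos hfaith) (fun w => hu.entire_right (v w))
      (fun z => hv.entire_left (u z))).comp (differentiable_id.prodMk differentiable_neg)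
  have hper : Function.Periodic (fun z => φ (u z * v (-z))) I := fun z => by
    have h : v I * v (-I) = 1 := by rw [← hv.map_add hfaith, add_neg_cancel, hv.map_zero]
    simp only [neg_add_rev, hu.map_add hfaith, hv.map_add hfaith, hI]
    rw [mul_assoc, ← mul_assoc (v I), h, one_mul]
  let B : ℝ → ℝ := fun s => (φ (u (2 * s * I))).re * (φ (v (2 * (-s : ℝ) * I))).re
  have hB : Continuous B :=
    (continuous_re.comp (hu.continuous_map_comp (by fun_prop))).mul
      (continuous_re.comp (hv.continuous_map_comp (by fun_prop)))
  obtain ⟨C, hC⟩ := (isCompact_Icc (a := (0 : ℝ)) (b := 1)).bddAbove_image hB.continuousOn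
  have hbound : ∀ z, ‖φ (u z * v (-z))‖ ≤ √C := fun z => by
    rw [← hper.sub_int_mul_eq ⌊z.im⌋]
    refine Real.le_sqrt_of_sq_le ((sq_norm_map_mul_le hpos _ _).trans ?_)
    rw [hu.map_mul_star hpos hfaith, hv.map_star_mul hpos hfaith, neg_im]
    refine hC ⟨_, ?_, rfl⟩
    simp [(Int.fract_lt_one z.im).le]
  have h := hd.apply_eq_apply_of_bounded
    (isBounded_iff_forall_norm_le.2 ⟨√C, by rintro _ ⟨z, rfl⟩; exact hbound z⟩) z 0
  simpa [hu.map_zero, hv.map_zero] using h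

theorem eq_ofReal (hu : AnalyticUnitaryRep φ u) (hv : AnalyticUnitaryRep φ v)
    (hpos : ∀ a : A, 0 ≤ φ (star a * a)) (hfaith : ∀ a : A, φ (star a * a) = 0 → a = 0)
    (hI : u I = v I) (t : ℝ) : u t = v t := by
  refine sub_eq_zero.1 (star_eq_zero.1 (hfaith _ ?_))
  have h := hu.map_mul_neg_eq hv hpos hfaith hI t
  have h' := hv.map_mul_neg_eq hu hpos hfaith hI.symm t
  rw [star_star, star_sub, sub_mul, mul_sub, mul_sub, (hu.real_unitary t).2,
    (hv.real_unitary t).2, hu.star_ofReal, hv.star_ofReal]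
  simp only [map_sub, h, h', sub_self]

end AnalyticUnitaryRep

end PositiveFunctional

/-- Analytic unitary representations are determined by their value at `i` :
if `u i = v i` then `u = v`. -/
theorem analyticUnitaryRep_eq_of_eq_at_I {A : Type*} [Ring A] [Algebra ℂ A] [StarRing A] [StarModule ℂ A]
    (φ : A →ₗ[ℂ] ℂ)
    (hpos : ∀ a : A, 0 ≤ φ (star a * a))
    (hfaith : ∀ a : A, φ (star a * a) = 0 → a = 0)
    (u : ℂ → A) (hu : AnalyticUnitaryRep φ u)
    (v : ℂ → A) (hv : AnalyticUnitaryRep φ v)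
    (hI : u Complex.I = v Complex.I) :
    ∀ z : ℂ, u z = v z := by
  exact fun z => eq_of_forall_map_mul_left_eq hfaith fun a =>
    Differentiable.eq_of_eq_ofReal (hu.entire_left a) (hv.entire_left a)
      (fun t => by rw [hu.eq_ofReal hv hpos hfaith hI t]) z
end
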